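/- Realisation: if S4V⁻ ⊢ F then there exists a normal realisation r (substituting proof terms for the □'s of F, with proof variables at all negative occurrences of □) such that LPV⁻ ⊢ F^r; similarly if S4V ⊢ F then LPV ⊢ F^r for some normal realisation r. -/

import Mathlib

/-- Formulas of intuitionistic epistemic logic. -/
inductive IForm : Type
  | atom : ℕ → IForm
  | bot  : IForm
  | and  : IForm → IForm → IForm
  | or   : IForm → IForm → IForm
  | imp  : IForm → IForm → IForm
  | K    : IForm → IForm

def IForm.neg (A : IForm) : IForm := A.imp .bot

/-- Hilbert-style derivability for IEL⁻ together with an extra axiom set `Ax`. -/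
inductive IELDeriv (Ax : IForm → Prop) : IForm → Prop
  | extra {A : IForm} : Ax A → IELDeriv Ax A
  | a1 (A B : IForm) : IELDeriv Ax (A.imp (B.imp A))
  | a2 (A B C : IForm) : IELDeriv Ax ((A.imp (B.imp C)).imp ((A.imp B).imp (A.imp C)))
  | andI (A B : IForm) : IELDeriv Ax (A.imp (B.imp (A.and B)))
  | andE1 (A B : IForm) : IELDeriv Ax ((A.and B).imp A)
  | andE2 (A B : IForm) : IELDeriv Ax ((A.and B).imp B)
  | orI1 (A B : IForm) : IELDeriv Ax (A.imp (A.or B))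
  | orI2 (A B : IForm) : IELDeriv Ax (B.imp (A.or B))
  | orE (A B C : IForm) : IELDeriv Ax ((A.imp C).imp ((B.imp C).imp ((A.or B).imp C)))
  | exfalso (A : IForm) : IELDeriv Ax (IForm.bot.imp A)
  | kdist (A B : IForm) : IELDeriv Ax ((IForm.K (A.imp B)).imp ((IForm.K A).imp (IForm.K B)))
  | coref (A : IForm) : IELDeriv Ax (A.imp (IForm.K A))
  | mp {A B : IForm} : IELDeriv Ax (A.imp B) → IELDeriv Ax A → IELDeriv Ax B

/-- Derivability in IEL⁻. -/
def IELm : IForm → Prop := IELDeriv (fun _ => False)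

/-- Derivability in IEL: IEL⁻ plus the axiom schema KA → ¬¬A. -/
def IEL : IForm → Prop :=
  IELDeriv (fun F => ∃ A : IForm, F = (IForm.K A).imp A.neg.neg)


/-- Formulas of classical bimodal logic with □ (provability) and V (verification). -/
inductive MForm : Type
  | atom : ℕ → MForm
  | bot  : MForm
  | and  : MForm → MForm → MForm
  | or   : MForm → MForm → MForm
  | imp  : MForm → MForm → MForm
  | box  : MForm → MForm
  | V    : MForm → MForm

def MForm.neg (A : MForm) : MForm := A.imp .bot

/-- Hilbert-style derivability for S4V⁻ (`strong = false`) and S4V (`strong = true`,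
adding the axiom ¬□V⊥). -/
inductive S4VDeriv (strong : Bool) : MForm → Prop
  | a1 (A B : MForm) : S4VDeriv strong (A.imp (B.imp A))
  | a2 (A B C : MForm) : S4VDeriv strong ((A.imp (B.imp C)).imp ((A.imp B).imp (A.imp C)))
  | andI (A B : MForm) : S4VDeriv strong (A.imp (B.imp (A.and B)))
  | andE1 (A B : MForm) : S4VDeriv strong ((A.and B).imp A)
  | andE2 (A B : MForm) : S4VDeriv strong ((A.and B).imp B)
  | orI1 (A B : MForm) : S4VDeriv strong (A.imp (A.or B))
  | orI2 (A B : MForm) : S4VDeriv strong (B.imp (A.or B))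
  | orE (A B C : MForm) : S4VDeriv strong ((A.imp C).imp ((B.imp C).imp ((A.or B).imp C)))
  | exfalso (A : MForm) : S4VDeriv strong (MForm.bot.imp A)
  | dne (A : MForm) : S4VDeriv strong (A.neg.neg.imp A)
  | boxK (A B : MForm) : S4VDeriv strong ((A.imp B).box.imp (A.box.imp B.box))
  | boxT (A : MForm) : S4VDeriv strong (A.box.imp A)
  | box4 (A : MForm) : S4VDeriv strong (A.box.imp A.box.box)
  | vK (A B : MForm) : S4VDeriv strong ((MForm.V (A.imp B)).imp ((MForm.V A).imp (MForm.V B)))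
  | boxV (A : MForm) : S4VDeriv strong (A.box.imp (MForm.V A))
  | consis : strong = true → S4VDeriv strong ((MForm.V MForm.bot).box.neg)
  | mp {A B : MForm} : S4VDeriv strong (A.imp B) → S4VDeriv strong A → S4VDeriv strong B
  | nec {A : MForm} : S4VDeriv strong A → S4VDeriv strong A.box

/-- Proof terms of the logic of proofs. -/
inductive Tm : Type
  | var   : ℕ → Tm
  | const : ℕ → Tm
  | app   : Tm → Tm → Tm
  | sum   : Tm → Tm → Tm
  | bang  : Tm → Tm

/-- A ground term contains no proof variables. -/
def Tm.ground : Tm → Prop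
  | .var _ => False
  | .const _ => True
  | .app t s => t.ground ∧ s.ground
  | .sum t s => t.ground ∧ s.ground
  | .bang t => t.ground

/-- Proof variables occurring in a term. -/
def Tm.vars : Tm → List ℕ
  | .var x => [x]
  | .const _ => []
  | .app t s => t.vars ++ s.vars
  | .sum t s => t.vars ++ s.vars
  | .bang t => t.vars

/-- Formulas of the logics LPV⁻ / LPV of explicit proofs and verification. -/
inductive LForm : Type
  | atom : ℕ → LForm
  | bot  : LForm
  | and  : LForm → LForm → LForm
  | or   : LForm → LForm → LForm
  | imp  : LForm → LForm → LForm
  | V    : LForm → LForm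
  | pf   : Tm → LForm → LForm

def LForm.neg (A : LForm) : LForm := A.imp .bot

/-- Proof variables occurring in a formula. -/
def LForm.vars : LForm → List ℕ
  | .atom _ => []
  | .bot => []
  | .and A B => A.vars ++ B.vars
  | .or A B => A.vars ++ B.vars
  | .imp A B => A.vars ++ B.vars
  | .V A => A.vars
  | .pf t A => t.vars ++ A.vars

/-- Axioms of LPV⁻ (`strong = false`) and LPV (`strong = true`, adding ¬t:V⊥). -/
inductive LAxiom (strong : Bool) : LForm → Prop
  | a1 (A B : LForm) : LAxiom strong (A.imp (B.imp A))
  | a2 (A B C : LForm) : LAxiom strong ((A.imp (B.imp C)).imp ((A.imp B).imp (A.imp C)))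
  | andI (A B : LForm) : LAxiom strong (A.imp (B.imp (A.and B)))
  | andE1 (A B : LForm) : LAxiom strong ((A.and B).imp A)
  | andE2 (A B : LForm) : LAxiom strong ((A.and B).imp B)
  | orI1 (A B : LForm) : LAxiom strong (A.imp (A.or B))
  | orI2 (A B : LForm) : LAxiom strong (B.imp (A.or B))
  | orE (A B C : LForm) : LAxiom strong ((A.imp C).imp ((B.imp C).imp ((A.or B).imp C)))
  | exfalso (A : LForm) : LAxiom strong (LForm.bot.imp A)
  | dne (A : LForm) : LAxiom strong (A.neg.neg.imp A)
  | appAx (t s : Tm) (A B : LForm) :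
      LAxiom strong ((LForm.pf t (A.imp B)).imp ((LForm.pf s A).imp (LForm.pf (t.app s) B)))
  | reflAx (t : Tm) (A : LForm) : LAxiom strong ((LForm.pf t A).imp A)
  | checkAx (t : Tm) (A : LForm) :
      LAxiom strong ((LForm.pf t A).imp (LForm.pf t.bang (LForm.pf t A)))
  | sum1 (t s : Tm) (A : LForm) : LAxiom strong ((LForm.pf t A).imp (LForm.pf (s.sum t) A))
  | sum2 (t s : Tm) (A : LForm) : LAxiom strong ((LForm.pf t A).imp (LForm.pf (t.sum s) A))
  | vK (A B : LForm) : LAxiom strong ((LForm.V (A.imp B)).imp ((LForm.V A).imp (LForm.V B)))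
  | pfV (t : Tm) (A : LForm) : LAxiom strong ((LForm.pf t A).imp (LForm.V A))
  | consis (t : Tm) : strong = true → LAxiom strong (LForm.pf t (LForm.V LForm.bot)).neg

/-- Hilbert-style derivability for LPV⁻ / LPV from a list of hypotheses, with
modus ponens and axiom necessitation. -/
inductive LDerivCtx (strong : Bool) (Γ : List LForm) : LForm → Prop
  | hyp {A : LForm} : A ∈ Γ → LDerivCtx strong Γ A
  | ax {A : LForm} : LAxiom strong A → LDerivCtx strong Γ A
  | mp {A B : LForm} : LDerivCtx strong Γ (A.imp B) → LDerivCtx strong Γ A → LDerivCtx strong Γ B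
  | nec {A : LForm} (c : ℕ) : LAxiom strong A → LDerivCtx strong Γ (LForm.pf (Tm.const c) A)

/-- Derivability in LPV⁻ / LPV (no hypotheses). -/
def LDeriv (strong : Bool) (A : LForm) : Prop := LDerivCtx strong [] A

/-- `Realz p F G` : the LPV-formula `G` is obtained from the modal formula `F`
(occurring with polarity `p`, `true` = positive) by substituting a proof term for
each occurrence of □, where every negative occurrence of □ receives a proof
variable (normality). -/
inductive Realz : Bool → MForm → LForm → Prop
  | atom (p : Bool) (n : ℕ) : Realz p (MForm.atom n) (LForm.atom n)
  | bot (p : Bool) : Realz p MForm.bot LForm.bot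
  | and {p : Bool} {A B : MForm} {A' B' : LForm} :
      Realz p A A' → Realz p B B' → Realz p (A.and B) (A'.and B')
  | or {p : Bool} {A B : MForm} {A' B' : LForm} :
      Realz p A A' → Realz p B B' → Realz p (A.or B) (A'.or B')
  | imp {p : Bool} {A B : MForm} {A' B' : LForm} :
      Realz (!p) A A' → Realz p B B' → Realz p (A.imp B) (A'.imp B')
  | V {p : Bool} {A : MForm} {A' : LForm} : Realz p A A' → Realz p (MForm.V A) (LForm.V A')
  | boxPos {A : MForm} {A' : LForm} (t : Tm) :
      Realz true A A' → Realz true A.box (LForm.pf t A')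
  | boxNeg {A : MForm} {A' : LForm} (x : ℕ) :
      Realz false A A' → Realz false A.box (LForm.pf (Tm.var x) A')

theorem ldapp {s : Bool} {t r : Tm} {A B : LForm} (h : LDeriv s (LForm.pf t (A.imp B)))
    (h' : LDeriv s (LForm.pf r A)) : LDeriv s (LForm.pf (t.app r) B) :=
  LDerivCtx.mp (LDerivCtx.mp (LDerivCtx.ax (LAxiom.appAx t r A B)) h) h'

/-! ### Families of formulas indexed by a term -/

/-- A family of formulas, indexed by the term used for all positive boxes. -/
abbrev Fam := Tm → LForm

def Fam.imp (a b : Fam) : Fam := fun u => (a u).imp (b u)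
def Fam.bot : Fam := fun _ => LForm.bot
def Fam.neg (a : Fam) : Fam := a.imp Fam.bot
def Fam.V (a : Fam) : Fam := fun u => LForm.V (a u)
def Fam.pf (t : Tm) (a : Fam) : Fam := fun u => LForm.pf t (a u)
def Fam.upf (a : Fam) : Fam := fun u => LForm.pf u (a u)
def Fam.and (a b : Fam) : Fam := fun u => (a u).and (b u)
def Fam.or (a b : Fam) : Fam := fun u => (a u).or (b u)

/-- A set of families containing all axioms and closed under modus ponens. -/
structure Theory (s : Bool) (P : Fam → Prop) : Prop where
  ax : ∀ a : Fam, (∀ u, LAxiom s (a u)) → P a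
  mp : ∀ a b : Fam, P (a.imp b) → P a → P b

def imps : List Fam → Fam → Fam
  | [], b => b
  | a :: L, b => imps L (a.imp b)

/-- Provability from hypotheses. -/
def Th (P : Fam → Prop) (L : List Fam) (b : Fam) : Prop := P (imps L b)

namespace Theory

variable {s : Bool} {P : Fam → Prop}

theorem lift (T : Theory s P) (L : List Fam) : ∀ {b : Fam}, P b → Th P L b := by
  induction L with
  | nil => intro b h; exact h
  | cons a L ih =>
    intro b h
    have : P (a.imp b) := T.mp _ _ (T.ax (b.imp (a.imp b)) (fun u => LAxiom.a1 _ _)) h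
    exact ih this

theorem tax (T : Theory s P) {L : List Fam} (a : Fam) (h : ∀ u, LAxiom s (a u)) : Th P L a :=
  T.lift L (T.ax a h)

theorem tmp (T : Theory s P) {L : List Fam} : ∀ {a b : Fam},
    Th P L (a.imp b) → Th P L a → Th P L b := by
  induction L with
  | nil => intro a b h1 h2; exact T.mp _ _ h1 h2
  | cons c L ih =>
    intro a b h1 h2
    have h1' : Th P L (c.imp (a.imp b)) := h1
    have h2' : Th P L (c.imp a) := h2
    have h3 : Th P L ((c.imp (a.imp b)).imp ((c.imp a).imp (c.imp b))) :=
      T.tax _ (fun u => LAxiom.a2 _ _ _)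
    exact ih (ih h3 h1') h2'

theorem intro {L : List Fam} {a b : Fam} (h : Th P (a :: L) b) : Th P L (a.imp b) := h

theorem tid (T : Theory s P) {L : List Fam} (a : Fam) : Th P L (a.imp a) := by
  have h1 : Th P L ((a.imp ((a.imp a).imp a)).imp ((a.imp (a.imp a)).imp (a.imp a))) :=
    T.tax _ (fun u => LAxiom.a2 _ _ _)
  have h2 : Th P L (a.imp ((a.imp a).imp a)) := T.tax _ (fun u => LAxiom.a1 _ _)
  have h3 : Th P L (a.imp (a.imp a)) := T.tax _ (fun u => LAxiom.a1 _ _)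
  exact T.tmp (T.tmp h1 h2) h3

theorem hyp (T : Theory s P) {L : List Fam} : ∀ {a : Fam}, a ∈ L → Th P L a := by
  induction L with
  | nil => intro a h; simp at h
  | cons c L ih =>
    intro a h
    rcases List.mem_cons.1 h with rfl | h
    · exact T.tid a
    · have h2 : Th P L (a.imp (c.imp a)) := T.tax _ (fun u => LAxiom.a1 _ _)
      have h3 : Th P L (c.imp a) := T.tmp h2 (ih h)
      exact h3

/-- Cut: replace hypotheses by derivations of them. -/
theorem cut (T : Theory s P) {L : List Fam} {L' : List Fam} : ∀ {b : Fam},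
    Th P L b → (∀ a ∈ L, Th P L' a) → Th P L' b := by
  induction L with
  | nil => intro b h _; exact T.lift L' h
  | cons c L ih =>
    intro b h hL
    have h' : Th P L (c.imp b) := h
    exact T.tmp (ih h' (fun a ha => hL a (List.mem_cons_of_mem _ ha))) (hL c (by simp))

theorem weak (T : Theory s P) {L L' : List Fam} {b : Fam} (h : Th P L b)
    (hL : ∀ a ∈ L, a ∈ L') : Th P L' b :=
  T.cut h (fun a ha => T.hyp (hL a ha))

theorem dne (T : Theory s P) {L : List Fam} {a : Fam} (h : Th P L a.neg.neg) : Th P L a :=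
  T.tmp (T.tax (a.neg.neg.imp a) (fun u => LAxiom.dne _)) h

theorem byc (T : Theory s P) {L : List Fam} {a : Fam} (h : Th P (a.neg :: L) Fam.bot) :
    Th P L a := T.dne h

theorem exf (T : Theory s P) {L : List Fam} {a : Fam} (h : Th P L Fam.bot) : Th P L a :=
  T.tmp (T.tax (Fam.bot.imp a) (fun u => LAxiom.exfalso _)) h

theorem Vlift (T : Theory s P) {L : List Fam} (G : List Fam) : ∀ {b : Fam},
    Th P L (Fam.V (imps G b)) → (∀ a ∈ G, Th P L a.V) → Th P L b.V := by
  induction G with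
  | nil => intro b h _; exact h
  | cons c G ih =>
    intro b h hG
    have h1 : Th P L (Fam.V (c.imp b)) := ih h (fun a ha => hG a (List.mem_cons_of_mem _ ha))
    have h2 : Th P L ((Fam.V (c.imp b)).imp (c.V.imp b.V)) := T.tax _ (fun u => LAxiom.vK _ _)
    exact T.tmp (T.tmp h2 h1) (hG c (by simp))

theorem pflift (T : Theory s P) {L : List Fam} (B : List Fam) : ∀ {b : Fam} {t : Tm},
    Th P L (Fam.pf t (imps (B.map (Fam.pf (Tm.var 0))) b)) →
    (∀ a ∈ B, Th P L (Fam.pf (Tm.var 0) a)) → ∃ t' : Tm, Th P L (Fam.pf t' b) := by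
  induction B with
  | nil => intro b t h _; exact ⟨t, h⟩
  | cons c B ih =>
    intro b t h hG
    obtain ⟨t', h1⟩ : ∃ t' : Tm, Th P L (Fam.pf t' ((Fam.pf (Tm.var 0) c).imp b)) :=
      ih h (fun a ha => hG a (List.mem_cons_of_mem _ ha))
    have h2 : Th P L ((Fam.pf (Tm.var 0) c).imp
        (Fam.pf (Tm.var 0).bang (Fam.pf (Tm.var 0) c))) :=
      T.tax _ (fun u => LAxiom.checkAx _ _)
    have h3 := T.tmp h2 (hG c (by simp))
    have h4 : Th P L ((Fam.pf t' ((Fam.pf (Tm.var 0) c).imp b)).imp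
        ((Fam.pf (Tm.var 0).bang (Fam.pf (Tm.var 0) c)).imp
          (Fam.pf (t'.app (Tm.var 0).bang) b))) :=
      T.tax _ (fun u => LAxiom.appAx _ _ _ _)
    exact ⟨_, T.tmp (T.tmp h4 h1) h3⟩

end Theory

/-- Internalised provability, uniformly for all `u` satisfying `C`. -/
def EPr (s : Bool) (C : Tm → Prop) (a : Fam) : Prop :=
  ∃ t : Tm, ∀ u, C u → LDeriv s (LForm.pf t (a u))

theorem EPr.theory (s : Bool) (C : Tm → Prop) : Theory s (EPr s C) where
  ax a h := ⟨Tm.const 0, fun u _ => LDerivCtx.nec 0 (h u)⟩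
  mp := by
    rintro a b ⟨t, ht⟩ ⟨r, hr⟩
    exact ⟨t.app r, fun u hu => ldapp (ht u hu) (hr u hu)⟩

theorem EPr.mono {s : Bool} {C C' : Tm → Prop} {a : Fam} (h : EPr s C a)
    (hC : ∀ u, C' u → C u) : EPr s C' a := by
  obtain ⟨t, ht⟩ := h
  exact ⟨t, fun u hu => ht u (hC u hu)⟩

theorem EPr.nec {s : Bool} {C : Tm → Prop} {a : Fam} (h : EPr s C a) :
    ∃ t, EPr s C (Fam.pf t a) := by
  obtain ⟨t, ht⟩ := h
  exact ⟨t, t.bang, fun u hu => LDerivCtx.mp (LDerivCtx.ax (LAxiom.checkAx _ _)) (ht u hu)⟩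

/-- `t` is the `i`-th summand of `u`. -/
def SumAt : ℕ → Tm → Tm → Prop
  | 0, t, u => ∃ r : Tm, u = Tm.sum t r
  | i + 1, t, u => ∃ r v : Tm, u = Tm.sum r v ∧ SumAt i t v

theorem SumAt.exists (n : ℕ) : ∀ g : ℕ → Tm, ∃ u, ∀ i < n, SumAt i (g i) u := by
  induction n with
  | zero => intro g; exact ⟨Tm.const 0, fun i hi => by omega⟩
  | succ n ih =>
    intro g
    obtain ⟨v, hv⟩ := ih (fun i => g (i + 1))
    refine ⟨(g 0).sum v, ?_⟩
    intro i hi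
    cases i with
    | zero => exact ⟨v, rfl⟩
    | succ i => exact ⟨g 0, v, rfl, hv i (by omega)⟩

theorem SumAt.pr (s : Bool) (i : ℕ) : ∃ r : Tm, ∀ (t u : Tm) (A : LForm), SumAt i t u →
    LDeriv s (LForm.pf r ((LForm.pf t A).imp (LForm.pf u A))) := by
  induction i with
  | zero =>
    refine ⟨Tm.const 0, ?_⟩
    rintro t u A ⟨r, rfl⟩
    exact LDerivCtx.nec 0 (LAxiom.sum2 _ _ _)
  | succ i ih =>
    obtain ⟨r, hr⟩ := ih
    refine ⟨((Tm.const 0).app ((Tm.const 0).app (Tm.const 0))).app r, ?_⟩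
    rintro t u A ⟨q, v, rfl, hv⟩
    have h1 := hr t v A hv
    have h2 : LDeriv s (LForm.pf (Tm.const 0) ((LForm.pf v A).imp (LForm.pf (q.sum v) A))) :=
      LDerivCtx.nec 0 (LAxiom.sum1 _ _ _)
    have h3 : LDeriv s (LForm.pf (Tm.const 0) (((LForm.pf v A).imp (LForm.pf (q.sum v) A)).imp
        ((LForm.pf t A).imp ((LForm.pf v A).imp (LForm.pf (q.sum v) A))))) :=
      LDerivCtx.nec 0 (LAxiom.a1 _ _)
    exact ldapp (ldapp (LDerivCtx.nec 0 (LAxiom.a2 _ _ _)) (ldapp h3 h2)) h1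

def Slots (o n : ℕ) (g : ℕ → Tm) (u : Tm) : Prop := ∀ i, o ≤ i → i < n → SumAt i (g i) u

/-- Eventual internalised provability. -/
def DPr (s : Bool) (a : Fam) : Prop :=
  ∀ o, ∃ n g, o ≤ n ∧ EPr s (Slots o n g) a

theorem DPr.theory (s : Bool) : Theory s (DPr s) where
  ax a h := fun o => ⟨o, fun _ => Tm.const 0, le_refl _, (EPr.theory s _).ax a h⟩
  mp := by
    intro a b h1 h2 o
    obtain ⟨n, g, hn, h1⟩ := h1 o
    obtain ⟨m, g', hm, h2⟩ := h2 n
    refine ⟨m, fun i => if i < n then g i else g' i, by omega, ?_⟩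
    refine (EPr.theory s _).mp a b (h1.mono ?_) (h2.mono ?_)
    · intro u hu i h1 h2
      have := hu i h1 (by omega)
      simpa [h2] using this
    · intro u hu i h1 h2
      have := hu i (by omega) h2
      simpa [not_lt.2 h1] using this

theorem DPr.vnec {s : Bool} {a : Fam} (h : DPr s a) : DPr s a.V := by
  intro o
  obtain ⟨n, g, hn, h⟩ := h o
  obtain ⟨t, ht⟩ := h.nec
  exact ⟨n, g, hn, (EPr.theory s _).mp _ _
    ((EPr.theory s _).ax ((Fam.pf t a).imp a.V) (fun u => LAxiom.pfV _ _)) ht⟩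

theorem DPr.boxR {s : Bool} {B : List Fam} {a : Fam}
    (h : Th (DPr s) (B.map (Fam.pf (Tm.var 0))) a) :
    Th (DPr s) (B.map (Fam.pf (Tm.var 0))) a.upf := by
  intro o
  obtain ⟨n, g, hn, h⟩ := h o
  obtain ⟨t, ht⟩ := h.nec
  have T := EPr.theory s (Slots o n g)
  obtain ⟨t', ht'⟩ := T.pflift (L := B.map (Fam.pf (Tm.var 0))) B (T.lift _ ht)
    (fun b hb => T.hyp (List.mem_map_of_mem hb))
  refine ⟨n + 1, fun i => if i < n then g i else t', by omega, ?_⟩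
  have T' := EPr.theory s (Slots o (n + 1) (fun i => if i < n then g i else t'))
  have h1 : EPr s (Slots o (n + 1) (fun i => if i < n then g i else t'))
      ((Fam.pf t' a).imp a.upf) := by
    obtain ⟨r, hr⟩ := SumAt.pr s n
    refine ⟨r, fun u hu => hr t' u (a u) ?_⟩
    have := hu n hn (by omega)
    simpa using this
  have h2 : Th (EPr s (Slots o (n + 1) (fun i => if i < n then g i else t')))
      (B.map (Fam.pf (Tm.var 0))) (Fam.pf t' a) := by
    refine EPr.mono ht' ?_
    intro u hu i h1 h2
    have := hu i h1 (by omega)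
    simpa [h2] using this
  exact T'.tmp (T'.lift _ h1) h2

theorem DPr.out {s : Bool} {a : Fam} (h : DPr s a) : ∃ u, LDeriv s (a u) := by
  obtain ⟨n, g, hn, t, ht⟩ := h 0
  obtain ⟨u, hu⟩ := SumAt.exists n g
  exact ⟨u, LDerivCtx.mp (LDerivCtx.ax (LAxiom.reflAx _ _)) (ht u (fun i _ hi => hu i hi))⟩

/-! ### Signed formulas and their realisations -/

/-- Realise all negative boxes by the variable 0, all positive ones by `u`. -/
def rz (u : Tm) : Bool → MForm → LForm
  | _, .atom n => .atom n
  | _, .bot => .bot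
  | p, .and A B => .and (rz u p A) (rz u p B)
  | p, .or A B => .or (rz u p A) (rz u p B)
  | p, .imp A B => .imp (rz u (!p) A) (rz u p B)
  | true, .box A => .pf u (rz u true A)
  | false, .box A => .pf (.var 0) (rz u false A)
  | p, .V A => .V (rz u p A)

theorem rz_realz (u : Tm) (A : MForm) : ∀ p, Realz p A (rz u p A) := by
  induction A with
  | atom n => intro p; cases p <;> exact Realz.atom _ _
  | bot => intro p; cases p <;> exact Realz.bot _
  | and A B ihA ihB => intro p; cases p <;> exact Realz.and (ihA _) (ihB _)
  | or A B ihA ihB => intro p; cases p <;> exact Realz.or (ihA _) (ihB _)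
  | imp A B ihA ihB => intro p; cases p <;> exact Realz.imp (ihA _) (ihB _)
  | V A ih => intro p; cases p <;> exact Realz.V (ih _)
  | box A ih =>
    intro p
    cases p
    · exact Realz.boxNeg _ (ih _)
    · exact Realz.boxPos _ (ih _)

/-- Families of negative (`nf`) and positive (`pf`) realisations. -/
def nf (A : MForm) : Fam := fun u => rz u false A
def pof (A : MForm) : Fam := fun u => rz u true A

def tr : Bool × MForm → Fam
  | (true, A) => nf A
  | (false, A) => (pof A).neg

def SCon (s : Bool) (S : Set (Bool × MForm)) : Prop :=
  ∀ L : List (Bool × MForm), (∀ a ∈ L, a ∈ S) → ¬ Th (DPr s) (L.map tr) Fam.bot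

def Wd (s : Bool) := {S : Set (Bool × MForm) // Maximal (SCon s) S}

theorem SCon.extend {s : Bool} {S : Set (Bool × MForm)} (h : SCon s S) :
    ∃ M : Wd s, S ⊆ M.1 := by
  obtain ⟨M, hSM, hM⟩ := zorn_subset_nonempty {S | SCon s S} (by
    intro c hc hch hne
    refine ⟨⋃₀ c, ?_, fun x hx => Set.subset_sUnion_of_mem hx⟩
    intro L hL
    have key : ∀ L : List (Bool × MForm), (∀ a ∈ L, a ∈ ⋃₀ c) → ∃ X ∈ c, ∀ a ∈ L, a ∈ X := by
      intro L
      induction L with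
      | nil =>
        intro _
        obtain ⟨X, hX⟩ := hne
        exact ⟨X, hX, by simp⟩
      | cons a L ih =>
        intro hL
        obtain ⟨X, hX, h1⟩ := ih (fun b hb => hL b (List.mem_cons_of_mem _ hb))
        obtain ⟨Y, hY, h2⟩ := hL a (by simp)
        rcases hch.total hX hY with h | h
        · refine ⟨Y, hY, ?_⟩
          intro b hb
          rcases List.mem_cons.1 hb with rfl | hb
          · exact h2
          · exact h (h1 b hb)
        · refine ⟨X, hX, ?_⟩
          intro b hb
          rcases List.mem_cons.1 hb with rfl | hb
          · exact h h2
          · exact h1 b hb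
    obtain ⟨X, hX, h1⟩ := key L hL
    exact hc hX L h1) S h
  exact ⟨⟨M, hM⟩, hSM⟩

section worlds

variable {s : Bool}

theorem Wd.con (M : Wd s) : SCon s M.1 := M.2.prop

theorem Wd.notMem (M : Wd s) {a : Bool × MForm} (h : a ∉ M.1) :
    ∃ L : List (Bool × MForm), (∀ b ∈ L, b ∈ M.1) ∧ Th (DPr s) ((a :: L).map tr) Fam.bot := by
  have h1 : ¬ SCon s (insert a M.1) := by
    intro hc
    exact h (M.2.le_of_ge hc (Set.subset_insert _ _) (Set.mem_insert _ _))
  unfold SCon at h1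
  push Not at h1
  obtain ⟨L, hL, h2⟩ := h1
  classical
  refine ⟨L.filter (fun b => decide (b ≠ a)), ?_, ?_⟩
  · intro b hb
    simp only [List.mem_filter, decide_eq_true_eq] at hb
    rcases hL b hb.1 with h | h
    · exact absurd h hb.2
    · exact h
  · refine (DPr.theory s).weak h2 ?_
    intro f hf
    obtain ⟨b, hb, rfl⟩ := List.mem_map.1 hf
    refine List.mem_map_of_mem ?_
    by_cases hba : b = a
    · simp [hba]
    · simp [hba, hb]

theorem Wd.sat2 (M : Wd s) {a b c : Bool × MForm} (ha : a ∈ M.1)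
    (h : Th (DPr s) [(tr c).neg, (tr b).neg, tr a] Fam.bot) : b ∈ M.1 ∨ c ∈ M.1 := by
  by_contra hbc
  push Not at hbc
  obtain ⟨L1, hL1, h1⟩ := M.notMem hbc.1
  obtain ⟨L2, hL2, h2⟩ := M.notMem hbc.2
  have T := DPr.theory s
  refine M.con (a :: (L1 ++ L2)) ?_ ?_
  · intro x hx
    simp only [List.mem_cons, List.mem_append] at hx
    rcases hx with rfl | hx | hx
    · exact ha
    · exact hL1 x hx
    · exact hL2 x hx
  · refine T.cut h ?_
    have e1 : Th (DPr s) ((a :: (L1 ++ L2)).map tr) (tr b).neg := by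
      refine T.weak (L := L1.map tr) (Theory.intro h1) ?_
      intro f hf
      simp only [List.map_cons, List.map_append, List.mem_cons, List.mem_append]
      exact Or.inr (Or.inl hf)
    have e2 : Th (DPr s) ((a :: (L1 ++ L2)).map tr) (tr c).neg := by
      refine T.weak (L := L2.map tr) (Theory.intro h2) ?_
      intro f hf
      simp only [List.map_cons, List.map_append, List.mem_cons, List.mem_append]
      exact Or.inr (Or.inr hf)
    intro f hf
    simp only [List.mem_cons, List.not_mem_nil, or_false] at hf
    rcases hf with rfl | rfl | rfl
    · exact e2
    · exact e1
    · exact T.hyp (by simp)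

theorem Wd.sat1 (M : Wd s) {a b : Bool × MForm} (ha : a ∈ M.1)
    (h : Th (DPr s) [tr a] (tr b)) : b ∈ M.1 := by
  have T := DPr.theory s
  have : b ∈ M.1 ∨ b ∈ M.1 := by
    refine M.sat2 ha ?_
    refine T.tmp (a := tr b) (T.hyp (by simp [Fam.neg])) (T.weak h (by simp))
  exact this.elim id id

def Wd.R (M N : Wd s) : Prop := ∀ A, (true, MForm.box A) ∈ M.1 → (true, MForm.box A) ∈ N.1

def Wd.RV (M N : Wd s) : Prop := M.R N ∧ ∀ A, (true, MForm.V A) ∈ M.1 → (true, A) ∈ N.1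

theorem Wd.box_mem (M : Wd s) {A : MForm} (h : (true, MForm.box A) ∈ M.1) : (true, A) ∈ M.1 := by
  have T := DPr.theory s
  refine M.sat1 h ?_
  refine T.tmp (a := nf (MForm.box A)) (T.tax _ (fun u => LAxiom.reflAx _ _)) (T.hyp ?_)
  simp [tr]

/-- Common form of the successor construction: a set of the shape
`{T B | X B} ∪ {F A}` that is inconsistent gives a derivation of `A` from `X`. -/
theorem con_fail {X : Set MForm} {A : MForm}
    (h : ¬ SCon s ({a | a.1 = true ∧ a.2 ∈ X} ∪ {(false, A)})) :
    ∃ G : List MForm, (∀ B ∈ G, B ∈ X) ∧ Th (DPr s) (G.map nf) (pof A) := by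
  have T := DPr.theory s
  unfold SCon at h
  push Not at h
  obtain ⟨L, hL, h⟩ := h
  refine ⟨(L.filter (fun a => a.1)).map Prod.snd, ?_, ?_⟩
  · intro B hB
    obtain ⟨a, ha, rfl⟩ := List.mem_map.1 hB
    simp only [List.mem_filter] at ha
    rcases hL a ha.1 with h | h
    · exact h.2
    · rw [Set.mem_singleton_iff.1 h] at ha
      simp at ha
  · refine T.byc (T.weak h ?_)
    intro f hf
    obtain ⟨a, ha, rfl⟩ := List.mem_map.1 hf
    rcases hL a ha with h | h
    · obtain ⟨p, B⟩ := a
      obtain ⟨h1, h2⟩ := h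
      simp only at h1
      subst h1
      refine List.mem_cons_of_mem _ ?_
      refine List.mem_map.2 ⟨B, List.mem_map.2 ⟨(true, B), ?_, rfl⟩, rfl⟩
      simp [ha]
    · rw [Set.mem_singleton_iff.1 h]
      simp [tr]

theorem boxes_of {X : Set MForm} (G : List MForm) (hG : ∀ B ∈ G, B ∈ MForm.box '' X) :
    ∃ H : List MForm, (∀ B ∈ H, B ∈ X) ∧ G = H.map MForm.box := by
  induction G with
  | nil => exact ⟨[], by simp, rfl⟩
  | cons a G ih =>
    obtain ⟨H, h1, h2⟩ := ih (fun B hB => hG B (List.mem_cons_of_mem _ hB))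
    obtain ⟨b, hb, rfl⟩ := hG a (by simp)
    refine ⟨b :: H, ?_, by simp [h2]⟩
    intro B hB
    rcases List.mem_cons.1 hB with rfl | hB
    · exact hb
    · exact h1 B hB

theorem map_nf_box (H : List MForm) :
    (H.map MForm.box).map nf = (H.map nf).map (Fam.pf (Tm.var 0)) := by
  simp only [List.map_map]
  rfl

/-- If `A` is derivable from `T`-members of a world then `F A` is not in it. -/
theorem Wd.not_false (M : Wd s) {G : List MForm} {A : MForm} (hG : ∀ B ∈ G, (true, B) ∈ M.1)
    (h : Th (DPr s) (G.map nf) (pof A)) : (false, A) ∉ M.1 := by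
  intro hA
  have T := DPr.theory s
  refine M.con ((false, A) :: G.map (fun B => (true, B))) ?_ ?_
  · intro x hx
    rcases List.mem_cons.1 hx with rfl | hx
    · exact hA
    · obtain ⟨B, hB, rfl⟩ := List.mem_map.1 hx
      exact hG B hB
  · refine T.tmp (a := pof A) (T.hyp (by simp [tr, Fam.neg])) (T.weak h ?_)
    intro f hf
    obtain ⟨B, hB, rfl⟩ := List.mem_map.1 hf
    refine List.mem_map.2 ⟨(true, B), ?_, rfl⟩
    simp [hB]

theorem Wd.box_succ (M : Wd s) {A : MForm} (h : (false, MForm.box A) ∈ M.1) :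
    ∃ N : Wd s, M.R N ∧ (false, A) ∈ N.1 := by
  by_cases hc : SCon s ({a | a.1 = true ∧ a.2 ∈ MForm.box '' {B | (true, MForm.box B) ∈ M.1}}
      ∪ {(false, A)})
  · obtain ⟨N, hN⟩ := hc.extend
    exact ⟨N, fun B hB => hN (Or.inl ⟨rfl, B, hB, rfl⟩), hN (Or.inr rfl)⟩
  · exfalso
    obtain ⟨G, hG, hd⟩ := con_fail hc
    obtain ⟨H, hH, rfl⟩ := boxes_of G hG
    rw [map_nf_box] at hd
    have h2 := DPr.boxR hd
    rw [← map_nf_box] at h2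
    refine M.not_false ?_ (A := MForm.box A) h2 h
    intro B hB
    obtain ⟨C, hC, rfl⟩ := List.mem_map.1 hB
    exact hH C hC

theorem Wd.V_succ (M : Wd s) {A : MForm} (h : (false, MForm.V A) ∈ M.1) :
    ∃ N : Wd s, M.RV N ∧ (false, A) ∈ N.1 := by
  by_cases hc : SCon s ({a | a.1 = true ∧ a.2 ∈ (MForm.box '' {B | (true, MForm.box B) ∈ M.1}
      ∪ {B | (true, MForm.V B) ∈ M.1})} ∪ {(false, A)})
  · obtain ⟨N, hN⟩ := hc.extend
    exact ⟨N, ⟨fun B hB => hN (Or.inl ⟨rfl, Or.inl ⟨B, hB, rfl⟩⟩),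
      fun B hB => hN (Or.inl ⟨rfl, Or.inr hB⟩)⟩, hN (Or.inr rfl)⟩
  · exfalso
    have T := DPr.theory s
    obtain ⟨G, hG, hd⟩ := con_fail hc
    -- every member of `G` is verified by some member of the world
    have key : ∀ G : List MForm, (∀ B ∈ G, B ∈ (MForm.box '' {B | (true, MForm.box B) ∈ M.1}
      ∪ {B | (true, MForm.V B) ∈ M.1})) → ∃ H : List MForm, (∀ B ∈ H, (true, B) ∈ M.1) ∧
        ∀ B ∈ G, Th (DPr s) (H.map nf) (nf B).V := by
      intro G
      induction G with
      | nil => intro _; exact ⟨[], by simp, by simp⟩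
      | cons a G ih =>
        intro hG
        obtain ⟨H, h1, h2⟩ := ih (fun B hB => hG B (List.mem_cons_of_mem _ hB))
        have : ∃ b, (true, b) ∈ M.1 ∧ Th (DPr s) [nf b] (nf a).V := by
          rcases hG a (by simp) with ⟨b, hb, rfl⟩ | hb
          · refine ⟨MForm.box b, hb, ?_⟩
            have e1 : Th (DPr s) [nf b.box] (Fam.pf (Tm.var 0).bang (nf b.box)) :=
              T.tmp (a := nf b.box) (T.tax _ (fun u => LAxiom.checkAx _ _)) (T.hyp (by simp))
            exact T.tmp (T.tax _ (fun u => LAxiom.pfV (Tm.var 0).bang _)) e1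
          · exact ⟨MForm.V a, hb, T.hyp (by simp; rfl)⟩
        obtain ⟨b, hb, h3⟩ := this
        refine ⟨b :: H, ?_, ?_⟩
        · intro B hB
          rcases List.mem_cons.1 hB with rfl | hB
          · exact hb
          · exact h1 B hB
        · intro B hB
          rcases List.mem_cons.1 hB with rfl | hB
          · exact T.weak h3 (by simp)
          · refine T.weak (h2 B hB) ?_
            intro f hf
            exact List.mem_cons_of_mem _ hf
    obtain ⟨H, hH, hV⟩ := key G hG
    refine M.not_false (A := MForm.V A) hH ?_ h
    refine T.Vlift (b := pof A) (G.map nf) (T.lift _ (DPr.vnec hd)) ?_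
    intro f hf
    obtain ⟨B, hB, rfl⟩ := List.mem_map.1 hf
    exact hV B hB

theorem Wd.consis (hs : s = true) (M : Wd s) : ∃ N K : Wd s, M.R N ∧ N.RV K := by
  have : ∃ N : Wd s, M.R N ∧ (false, MForm.V MForm.bot) ∈ N.1 := by
    by_cases hc : SCon s ({a | a.1 = true ∧ a.2 ∈ MForm.box '' {B | (true, MForm.box B) ∈ M.1}}
        ∪ {(false, MForm.V MForm.bot)})
    · obtain ⟨N, hN⟩ := hc.extend
      exact ⟨N, fun B hB => hN (Or.inl ⟨rfl, B, hB, rfl⟩), hN (Or.inr rfl)⟩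
    · exfalso
      have T := DPr.theory s
      obtain ⟨G, hG, hd⟩ := con_fail hc
      obtain ⟨H, hH, rfl⟩ := boxes_of G hG
      rw [map_nf_box] at hd
      have h2 := DPr.boxR hd
      have h3 : Th (DPr s) ((H.map nf).map (Fam.pf (Tm.var 0))) Fam.bot :=
        T.tmp (T.tax _ (fun u => LAxiom.consis u hs)) h2
      rw [← map_nf_box] at h3
      refine M.con ((H.map MForm.box).map (fun B => (true, B))) ?_ ?_
      · intro x hx
        obtain ⟨B, hB, rfl⟩ := List.mem_map.1 hx
        obtain ⟨C, hC, rfl⟩ := List.mem_map.1 hB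
        exact hH C hC
      · refine T.weak h3 ?_
        intro f hf
        obtain ⟨B, hB, rfl⟩ := List.mem_map.1 hf
        exact List.mem_map.2 ⟨(true, B), List.mem_map.2 ⟨B, hB, rfl⟩, rfl⟩
  obtain ⟨N, h1, h2⟩ := this
  obtain ⟨K, h3, _⟩ := N.V_succ h2
  exact ⟨N, K, h1, h3⟩

/-- Kripke forcing in the canonical model. -/
def Wd.sat : MForm → Wd s → Prop
  | .atom n, M => (true, MForm.atom n) ∈ M.1
  | .bot, _ => False
  | .and A B, M => Wd.sat A M ∧ Wd.sat B M
  | .or A B, M => Wd.sat A M ∨ Wd.sat B M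
  | .imp A B, M => Wd.sat A M → Wd.sat B M
  | .box A, M => ∀ N : Wd s, M.R N → Wd.sat A N
  | .V A, M => ∀ N : Wd s, M.RV N → Wd.sat A N

theorem Wd.R.refl (M : Wd s) : M.R M := fun _ h => h
theorem Wd.R.trans {M N K : Wd s} (h : M.R N) (h' : N.R K) : M.R K := fun A hA => h' A (h A hA)

theorem Wd.sound {A : MForm} (h : S4VDeriv s A) : ∀ M : Wd s, Wd.sat A M := by
  induction h with
  | a1 A B => intro M h _; exact h
  | a2 A B C => intro M h1 h2 h3; exact h1 h3 (h2 h3)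
  | andI A B => intro M h1 h2; exact ⟨h1, h2⟩
  | andE1 A B => intro M h; exact h.1
  | andE2 A B => intro M h; exact h.2
  | orI1 A B => intro M h; exact Or.inl h
  | orI2 A B => intro M h; exact Or.inr h
  | orE A B C => intro M h1 h2 h; exact h.elim h1 h2
  | exfalso A => intro M h; exact h.elim
  | dne A => intro M h; exact Classical.byContradiction h
  | boxK A B => intro M h1 h2 N hN; exact h1 N hN (h2 N hN)
  | boxT A => intro M h; exact h M (Wd.R.refl M)
  | box4 A => intro M h N hN K hK; exact h K (hN.trans hK)
  | vK A B => intro M h1 h2 N hN; exact h1 N hN (h2 N hN)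
  | boxV A => intro M h N hN; exact h N hN.1
  | consis hs =>
    intro M h
    obtain ⟨N, K, h1, h2⟩ := M.consis hs
    exact h N h1 K h2
  | mp _ _ ih1 ih2 => intro M; exact ih1 M (ih2 M)
  | nec _ ih => intro M N _; exact ih N

theorem Wd.truth (A : MForm) : ∀ M : Wd s,
    ((true, A) ∈ M.1 → Wd.sat A M) ∧ ((false, A) ∈ M.1 → ¬ Wd.sat A M) := by
  have T := DPr.theory s
  induction A with
  | atom n =>
    intro M
    refine ⟨fun h => h, fun h h' => ?_⟩
    exact M.not_false (G := [MForm.atom n]) (by simpa [Wd.sat] using h') (T.hyp (by simp; rfl)) h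
  | bot =>
    intro M
    refine ⟨fun h => ?_, fun h h' => h'⟩
    exact M.con [(true, MForm.bot)] (by simpa using h) (T.hyp (by simp; rfl))
  | and A B ihA ihB =>
    intro M
    refine ⟨fun h => ⟨(ihA M).1 (M.sat1 h ?_), (ihB M).1 (M.sat1 h ?_)⟩, fun h => ?_⟩
    · exact T.tmp (a := nf (A.and B)) (T.tax _ (fun u => LAxiom.andE1 _ _)) (T.hyp (by simp [tr]))
    · exact T.tmp (a := nf (A.and B)) (T.tax _ (fun u => LAxiom.andE2 _ _)) (T.hyp (by simp [tr]))
    · have : (false, A) ∈ M.1 ∨ (false, B) ∈ M.1 := by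
        refine M.sat2 h ?_
        have hA : Th (DPr s) [(pof B).neg.neg, (pof A).neg.neg, (pof (A.and B)).neg] (pof A) :=
          T.dne (T.hyp (by simp))
        have hB : Th (DPr s) [(pof B).neg.neg, (pof A).neg.neg, (pof (A.and B)).neg] (pof B) :=
          T.dne (T.hyp (by simp))
        have hI : Th (DPr s) [(pof B).neg.neg, (pof A).neg.neg, (pof (A.and B)).neg]
          ((pof A).imp ((pof B).imp (pof (A.and B)))) := T.tax _ (fun u => LAxiom.andI _ _)
        exact T.tmp (a := pof (A.and B)) (T.hyp (by simp [tr, Fam.neg]))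
          (T.tmp (T.tmp hI hA) hB)
      rintro ⟨h1, h2⟩
      rcases this with h | h
      · exact (ihA M).2 h h1
      · exact (ihB M).2 h h2
  | or A B ihA ihB =>
    intro M
    refine ⟨fun h => ?_, fun h => ?_⟩
    · have : (true, A) ∈ M.1 ∨ (true, B) ∈ M.1 := by
        refine M.sat2 h ?_
        have hI : Th (DPr s) [(nf B).neg, (nf A).neg, nf (A.or B)]
          ((nf A).neg.imp ((nf B).neg.imp ((nf (A.or B)).imp Fam.bot))) :=
          T.tax _ (fun u => LAxiom.orE _ _ _)
        exact T.tmp (T.tmp (T.tmp hI (T.hyp (by simp [tr]))) (T.hyp (by simp [tr]))) (T.hyp (by simp [tr]))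
      rcases this with h | h
      · exact Or.inl ((ihA M).1 h)
      · exact Or.inr ((ihB M).1 h)
    · have hA : (false, A) ∈ M.1 := by
        refine M.sat1 h (Theory.intro (L := [tr (false, A.or B)]) (a := pof A) ?_)
        refine T.tmp (a := pof (A.or B)) (T.hyp (by simp [tr, Fam.neg])) ?_
        exact T.tmp (a := pof A) (T.tax _ (fun u => LAxiom.orI1 _ _)) (T.hyp (by simp))
      have hB : (false, B) ∈ M.1 := by
        refine M.sat1 h (Theory.intro (L := [tr (false, A.or B)]) (a := pof B) ?_)
        refine T.tmp (a := pof (A.or B)) (T.hyp (by simp [tr, Fam.neg])) ?_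
        exact T.tmp (a := pof B) (T.tax _ (fun u => LAxiom.orI2 _ _)) (T.hyp (by simp))
      rintro (h | h)
      · exact (ihA M).2 hA h
      · exact (ihB M).2 hB h
  | imp A B ihA ihB =>
    intro M
    refine ⟨fun h => ?_, fun h => ?_⟩
    · have : (false, A) ∈ M.1 ∨ (true, B) ∈ M.1 := by
        refine M.sat2 h ?_
        have hA : Th (DPr s) [(nf B).neg, (pof A).neg.neg, nf (A.imp B)] (pof A) :=
          T.dne (T.hyp (by simp))
        have hAB : Th (DPr s) [(nf B).neg, (pof A).neg.neg, nf (A.imp B)]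
          ((pof A).imp (nf B)) := T.hyp (a := nf (A.imp B)) (by simp)
        exact T.tmp (a := nf B) (T.hyp (by simp [tr, Fam.neg])) (T.tmp hAB hA)
      intro h1
      rcases this with h | h
      · exact ((ihA M).2 h h1).elim
      · exact (ihB M).1 h
    · have hA : (true, A) ∈ M.1 := by
        refine M.sat1 h (T.byc ?_)
        refine T.tmp (a := pof (A.imp B)) (T.hyp (by simp [tr, Fam.neg])) ?_
        refine Theory.intro (a := nf A) (b := pof B) (T.exf ?_)
        exact T.tmp (a := nf A) (T.hyp (by simp [tr, Fam.neg])) (T.hyp (by simp))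
      have hB : (false, B) ∈ M.1 := by
        refine M.sat1 h (Theory.intro (L := [tr (false, A.imp B)]) (a := pof B) ?_)
        refine T.tmp (a := pof (A.imp B)) (T.hyp (by simp [tr, Fam.neg])) ?_
        exact T.tmp (a := pof B) (T.tax _ (fun u => LAxiom.a1 _ _)) (T.hyp (by simp))
      intro h
      exact (ihB M).2 hB (h ((ihA M).1 hA))
  | box A ih =>
    intro M
    refine ⟨fun h N hN => (ih N).1 (N.box_mem (hN A h)), fun h hs => ?_⟩
    obtain ⟨N, h1, h2⟩ := M.box_succ h
    exact (ih N).2 h2 (hs N h1)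
  | V A ih =>
    intro M
    refine ⟨fun h N hN => (ih N).1 (hN.2 A h), fun h hs => ?_⟩
    obtain ⟨N, h1, h2⟩ := M.V_succ h
    exact (ih N).2 h2 (hs N h1)

end worlds

/-- Realisation: if S4V⁻ ⊢ F then LPV⁻ ⊢ F^r for some normal
realisation r, and if S4V ⊢ F then LPV ⊢ F^r for some normal realisation r. -/
theorem s4v_realisation (strong : Bool) (F : MForm) (h : S4VDeriv strong F) :
    ∃ G : LForm, Realz true F G ∧ LDeriv strong G := by
  by_cases hc : SCon strong ({a | a.1 = true ∧ a.2 ∈ (∅ : Set MForm)} ∪ {(false, F)})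
  · obtain ⟨M, hM⟩ := hc.extend
    exact absurd (Wd.sound h M) ((Wd.truth F M).2 (hM (Or.inr rfl)))
  · obtain ⟨G, hG, hd⟩ := con_fail hc
    have hG0 : G = [] := List.eq_nil_iff_forall_not_mem.2 (fun B hB => hG B hB)
    subst hG0
    obtain ⟨u, hu⟩ := DPr.out (a := pof F) hd
    exact ⟨rz u true F, rz_realz u F true, hu⟩
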